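/- Let n ≥ 3 and let F be a Finsler metric on an open set U ⊆ ℝⁿ of sectional flag curvature. Then for each x ∈ U, every y ∈ ℝⁿ ∖ {0} satisfies at least one of the following two conditions: (1) y is a polar direction at x; (2) the Matsumoto torsion vanishes at (x, y), i.e. M_{ijk}(x, y) = 0 for all i, j, k. -/

import Mathlib

open scoped BigOperators
open MeasureTheory

noncomputable section

namespace Paper

/-- `E n` is the model space ℝⁿ. -/
abbrev E (n : ℕ) := Fin n → ℝ

/-- `e n i` is the `i`-th standard basis vector of ℝⁿ. -/
def e (n : ℕ) (i : Fin n) : E n := Pi.single i 1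

/-- Partial derivative of `f(x,y)` in the fiber variable `y^i`. -/
def pdy (n : ℕ) (f : E n → E n → ℝ) (i : Fin n) : E n → E n → ℝ :=
  fun x y => fderiv ℝ (f x) y (e n i)

/-- Partial derivative of `f(x,y)` in the base variable `x^k`. -/
def pdx (n : ℕ) (f : E n → E n → ℝ) (k : Fin n) : E n → E n → ℝ :=
  fun x y => fderiv ℝ (fun x' => f x' y) x (e n k)

/-- The square `F²` of the metric. -/
def F2 (n : ℕ) (F : E n → E n → ℝ) : E n → E n → ℝ := fun x y => (F x y) ^ 2

/-- Fundamental tensor `g_{ij} = ½ [F²]_{y^i y^j}`. -/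
def gm (n : ℕ) (F : E n → E n → ℝ) (i j : Fin n) : E n → E n → ℝ :=
  fun x y => (1 / 2 : ℝ) * pdy n (pdy n (F2 n F) j) i x y

/-- The fundamental tensor as a matrix. -/
def gmat (n : ℕ) (F : E n → E n → ℝ) (x y : E n) : Matrix (Fin n) (Fin n) ℝ :=
  Matrix.of fun i j => gm n F i j x y

/-- The inverse fundamental tensor `g^{ij}`. -/
def ginv (n : ℕ) (F : E n → E n → ℝ) (x y : E n) : Matrix (Fin n) (Fin n) ℝ :=
  (gmat n F x y)⁻¹

/-- `F_{y^i}`. -/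
def Fy (n : ℕ) (F : E n → E n → ℝ) (i : Fin n) : E n → E n → ℝ := pdy n F i

/-- Angular metric `h_{ij} = g_{ij} - F_{y^i} F_{y^j}`. -/
def hm (n : ℕ) (F : E n → E n → ℝ) (i j : Fin n) : E n → E n → ℝ :=
  fun x y => gm n F i j x y - Fy n F i x y * Fy n F j x y

/-- Cartan tensor `C_{ijk} = ¼ [F²]_{y^i y^j y^k}`. -/
def Cartan (n : ℕ) (F : E n → E n → ℝ) (i j k : Fin n) : E n → E n → ℝ :=
  fun x y => (1 / 4 : ℝ) * pdy n (pdy n (pdy n (F2 n F) k) j) i x y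

/-- Mean Cartan tensor `I_i = g^{jk} C_{ijk}`. -/
def meanCartan (n : ℕ) (F : E n → E n → ℝ) (i : Fin n) : E n → E n → ℝ :=
  fun x y => ∑ j, ∑ k, ginv n F x y j k * Cartan n F i j k x y

/-- Matsumoto torsion `M_{ijk}`. -/
def Matsumoto (n : ℕ) (F : E n → E n → ℝ) (i j k : Fin n) : E n → E n → ℝ :=
  fun x y => Cartan n F i j k x y -
    (1 / ((n : ℝ) + 1)) * (hm n F i j x y * meanCartan n F k x y +
      hm n F j k x y * meanCartan n F i x y + hm n F k i x y * meanCartan n F j x y)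

/-- Spray coefficients `G^i = ¼ g^{il} ([F²]_{x^k y^l} y^k - [F²]_{x^l})`. -/
def Spray (n : ℕ) (F : E n → E n → ℝ) (i : Fin n) : E n → E n → ℝ :=
  fun x y => (1 / 4 : ℝ) * ∑ l, ginv n F x y i l *
    ((∑ k, pdx n (pdy n (F2 n F) l) k x y * y k) - pdx n (F2 n F) l x y)

/-- Riemann curvature `R^i_k`. -/
def RiemUp (n : ℕ) (F : E n → E n → ℝ) (i k : Fin n) : E n → E n → ℝ :=
  fun x y =>
    2 * pdx n (Spray n F i) k x y
    - (∑ j, y j * pdx n (pdy n (Spray n F i) k) j x y)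
    + 2 * (∑ j, Spray n F j x y * pdy n (pdy n (Spray n F i) k) j x y)
    - ∑ j, pdy n (Spray n F i) j x y * pdy n (Spray n F j) k x y

/-- Riemann curvature with lowered index `R_{jk} = g_{ij} R^i_k`. -/
def Rlow (n : ℕ) (F : E n → E n → ℝ) (j k : Fin n) : E n → E n → ℝ :=
  fun x y => ∑ i, gm n F i j x y * RiemUp n F i k x y

/-- Flag curvature `K(x,y,v)`. -/
def K (n : ℕ) (F : E n → E n → ℝ) (x y v : E n) : ℝ :=
  (∑ j, ∑ k, Rlow n F j k x y * v j * v k) /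
    ((F x y) ^ 2 * ∑ j, ∑ k, hm n F j k x y * v j * v k)

/-- `F` is a Finsler metric on the open set `U ⊆ ℝⁿ`. -/
structure IsFinsler (n : ℕ) (U : Set (E n)) (F : E n → E n → ℝ) : Prop where
  smooth : ContDiffOn ℝ (⊤ : ℕ∞) (fun p : E n × E n => F p.1 p.2) (U ×ˢ {y : E n | y ≠ 0})
  pos : ∀ x ∈ U, ∀ y : E n, y ≠ 0 → 0 < F x y
  homog : ∀ x ∈ U, ∀ y : E n, y ≠ 0 → ∀ c : ℝ, 0 < c → F x (c • y) = c * F x y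
  posdef : ∀ x ∈ U, ∀ y : E n, y ≠ 0 → (gmat n F x y).PosDef

/-- `F` is of sectional flag curvature: `K` only depends on the section. -/
def SectionalFlagCurv (n : ℕ) (U : Set (E n)) (F : E n → E n → ℝ) : Prop :=
  ∀ x ∈ U, ∀ y v y' v' : E n,
    LinearIndependent ℝ ![y, v] → LinearIndependent ℝ ![y', v'] →
    Submodule.span ℝ {y, v} = Submodule.span ℝ {y', v'} →
    K n F x y v = K n F x y' v'

/-- The flag curvature is isotropic at `x`. -/
def IsotropicAt (n : ℕ) (F : E n → E n → ℝ) (x : E n) : Prop :=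
  ∃ c : ℝ, ∀ y v : E n, LinearIndependent ℝ ![y, v] → K n F x y v = c

/-- The spray vector field `G = y^i ∂/∂x^i - 2G^i ∂/∂y^i` acting on a function of `(x,y)`. -/
def Gop (n : ℕ) (F f : E n → E n → ℝ) : E n → E n → ℝ :=
  fun x y => (∑ i, y i * pdx n f i x y) - 2 * ∑ i, Spray n F i x y * pdy n f i x y

/-- Dynamical derivative of a 1-index tensor. -/
def Dyn1 (n : ℕ) (F : E n → E n → ℝ) (T : Fin n → E n → E n → ℝ) (i : Fin n) :
    E n → E n → ℝ :=
  fun x y => Gop n F (T i) x y - ∑ m, pdy n (Spray n F m) i x y * T m x y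

/-- Dynamical derivative of a 2-index tensor. -/
def Dyn2 (n : ℕ) (F : E n → E n → ℝ) (T : Fin n → Fin n → E n → E n → ℝ) (i j : Fin n) :
    E n → E n → ℝ :=
  fun x y => Gop n F (T i j) x y - (∑ m, pdy n (Spray n F m) i x y * T m j x y)
    - ∑ m, pdy n (Spray n F m) j x y * T i m x y

/-- Dynamical derivative of a 3-index tensor. -/
def Dyn3 (n : ℕ) (F : E n → E n → ℝ) (T : Fin n → Fin n → Fin n → E n → E n → ℝ)
    (i j k : Fin n) : E n → E n → ℝ :=
  fun x y => Gop n F (T i j k) x y - (∑ m, pdy n (Spray n F m) i x y * T m j k x y)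
    - (∑ m, pdy n (Spray n F m) j x y * T i m k x y)
    - ∑ m, pdy n (Spray n F m) k x y * T i j m x y

/-- `y` is a polar direction at `x`: `R_{jk} = κ F² h_{jk}` for some constant `κ`. -/
def IsPolarDir (n : ℕ) (F : E n → E n → ℝ) (x y : E n) : Prop :=
  ∃ κ : ℝ, ∀ j k : Fin n, Rlow n F j k x y = κ * (F x y) ^ 2 * hm n F j k x y



open scoped ContDiff

/-- total directional derivative -/
def DD {n : ℕ} (u : E n × E n) (f : E n → E n → ℝ) : E n → E n → ℝ :=
  fun x y => fderiv ℝ (fun p : E n × E n => f p.1 p.2) (x, y) u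

/-- the domain -/
def Om {n : ℕ} (U : Set (E n)) : Set (E n × E n) := U ×ˢ {y : E n | y ≠ 0}

/-- smoothness on the domain -/
def Sm {n : ℕ} (U : Set (E n)) (f : E n → E n → ℝ) : Prop :=
  ContDiffOn ℝ ∞ (fun p : E n × E n => f p.1 p.2) (Om U)

/-- agreement on the domain -/
def EqOm {n : ℕ} (U : Set (E n)) (f g : E n → E n → ℝ) : Prop :=
  ∀ x ∈ U, ∀ y : E n, y ≠ 0 → f x y = g x y

section
variable {n : ℕ} {U : Set (E n)} {f g : E n → E n → ℝ}

lemma isOpen_Om (hU : IsOpen U) : IsOpen (Om U) := hU.prod isOpen_ne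

lemma Om_nhds (hU : IsOpen U) {x y : E n} (hx : x ∈ U) (hy : y ≠ 0) : Om U ∈ nhds (x, y) :=
  (isOpen_Om hU).mem_nhds ⟨hx, hy⟩

lemma Sm.contDiffAt (hf : Sm U f) (hU : IsOpen U) {x y : E n} (hx : x ∈ U) (hy : y ≠ 0) :
    ContDiffAt ℝ ∞ (fun p : E n × E n => f p.1 p.2) (x, y) :=
  ContDiffOn.contDiffAt hf (Om_nhds hU hx hy)

lemma Sm.diff (hf : Sm U f) (hU : IsOpen U) {x y : E n} (hx : x ∈ U) (hy : y ≠ 0) :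
    DifferentiableAt ℝ (fun p : E n × E n => f p.1 p.2) (x, y) :=
  (hf.contDiffAt hU hx hy).differentiableAt (by simp)

lemma Sm.congr (hf : Sm U f) (h : EqOm U g f) : Sm U g :=
  ContDiffOn.congr hf (fun p hp => h p.1 hp.1 p.2 hp.2)

lemma DD_congr (hU : IsOpen U) (h : EqOm U f g) (u : E n × E n) : EqOm U (DD u f) (DD u g) := by
  intro x hx y hy
  unfold DD
  have : (fun p : E n × E n => f p.1 p.2) =ᶠ[nhds (x, y)] (fun p : E n × E n => g p.1 p.2) := by
    filter_upwards [Om_nhds hU hx hy] with p hp using h p.1 hp.1 p.2 hp.2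
  rw [this.fderiv_eq]

lemma Sm.DD (hU : IsOpen U) (hf : Sm U f) (u : E n × E n) : Sm U (DD u f) := by
  have h1 : ContDiffOn ℝ ∞ (fderiv ℝ (fun p : E n × E n => f p.1 p.2)) (Om U) :=
    ContDiffOn.fderiv_of_isOpen hf (isOpen_Om hU) (by simp)
  exact h1.clm_apply contDiffOn_const

lemma pdy_eq (hU : IsOpen U) (hf : Sm U f) (i : Fin n) :
    EqOm U (pdy n f i) (Paper.DD (0, e n i) f) := by
  intro x hx y hy
  have h1 := (hf.diff hU hx hy).hasFDerivAt
  have h2 : HasFDerivAt (fun y' : E n => (x, y')) (ContinuousLinearMap.inr ℝ (E n) (E n)) y :=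
    hasFDerivAt_prodMk_right x y
  have h3 := h1.comp y h2
  have h4 : fderiv ℝ (f x) y = _ := h3.fderiv
  simp only [pdy, Paper.DD, h4]
  simp

lemma pdx_eq (hU : IsOpen U) (hf : Sm U f) (i : Fin n) :
    EqOm U (pdx n f i) (Paper.DD (e n i, 0) f) := by
  intro x hx y hy
  have h1 := (hf.diff hU hx hy).hasFDerivAt
  have h2 : HasFDerivAt (fun x' : E n => (x', y)) (ContinuousLinearMap.inl ℝ (E n) (E n)) x :=
    hasFDerivAt_prodMk_left x y
  have h3 := h1.comp x h2
  have h4 : fderiv ℝ (fun x' => f x' y) x = _ := h3.fderiv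
  simp only [pdx, Paper.DD, h4]
  simp

lemma Sm.pdy (hU : IsOpen U) (hf : Sm U f) (i : Fin n) : Sm U (pdy n f i) :=
  (hf.DD hU _).congr (pdy_eq hU hf i)
lemma Sm.pdx (hU : IsOpen U) (hf : Sm U f) (i : Fin n) : Sm U (pdx n f i) :=
  (hf.DD hU _).congr (pdx_eq hU hf i)

lemma Sm.add (hf : Sm U f) (hg : Sm U g) : Sm U (fun x y => f x y + g x y) :=
  ContDiffOn.add hf hg
lemma Sm.sub (hf : Sm U f) (hg : Sm U g) : Sm U (fun x y => f x y - g x y) :=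
  ContDiffOn.sub hf hg
lemma Sm.mul (hf : Sm U f) (hg : Sm U g) : Sm U (fun x y => f x y * g x y) :=
  ContDiffOn.mul hf hg
lemma Sm.const (c : ℝ) : Sm U (fun _ _ => c) := contDiffOn_const
lemma Sm.sum {ι : Type*} {s : Finset ι} {f : ι → E n → E n → ℝ} (hf : ∀ i, Sm U (f i)) :
    Sm U (fun x y => ∑ i ∈ s, f i x y) :=
  ContDiffOn.sum fun i _ => hf i
lemma Sm.prod {ι : Type*} {s : Finset ι} {f : ι → E n → E n → ℝ} (hf : ∀ i, Sm U (f i)) :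
    Sm U (fun x y => ∏ i ∈ s, f i x y) :=
  contDiffOn_prod fun i _ => hf i
lemma Sm.coord (k : Fin n) : Sm U (fun _ y => y k) := by
  unfold Sm
  fun_prop


lemma DD_mul (hU : IsOpen U) (hf : Sm U f) (hg : Sm U g) (u : E n × E n) 
    (x : E n) (hx : x ∈ U) (y : E n) (hy : y ≠ 0) :
    DD u (fun x y => f x y * g x y) x y = DD u f x y * g x y + f x y * DD u g x y := by
  unfold DD
  rw [fderiv_fun_mul (hf.diff hU hx hy) (hg.diff hU hx hy)]
  simp
  ring

lemma DD_sub (hU : IsOpen U) (hf : Sm U f) (hg : Sm U g) (u : E n × E n) 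
    (x : E n) (hx : x ∈ U) (y : E n) (hy : y ≠ 0) :
    DD u (fun x y => f x y - g x y) x y = DD u f x y - DD u g x y := by
  unfold DD
  rw [fderiv_fun_sub (hf.diff hU hx hy) (hg.diff hU hx hy)]
  simp

lemma DD_add (hU : IsOpen U) (hf : Sm U f) (hg : Sm U g) (u : E n × E n) 
    (x : E n) (hx : x ∈ U) (y : E n) (hy : y ≠ 0) :
    DD u (fun x y => f x y + g x y) x y = DD u f x y + DD u g x y := by
  unfold DD
  rw [fderiv_fun_add (hf.diff hU hx hy) (hg.diff hU hx hy)]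
  simp

lemma DD_cmul (hU : IsOpen U) (hf : Sm U f) (c : ℝ) (u : E n × E n) 
    (x : E n) (hx : x ∈ U) (y : E n) (hy : y ≠ 0) :
    DD u (fun x y => c * f x y) x y = c * DD u f x y := by
  unfold DD
  rw [fderiv_const_mul (hf.diff hU hx hy)]
  simp

lemma DD_sum (hU : IsOpen U) {ι : Type*} {s : Finset ι} {f : ι → E n → E n → ℝ} (hf : ∀ i, Sm U (f i))
    (u : E n × E n) 
    (x : E n) (hx : x ∈ U) (y : E n) (hy : y ≠ 0) :
    DD u (fun x y => ∑ i ∈ s, f i x y) x y = ∑ i ∈ s, DD u (f i) x y := by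
  unfold DD
  rw [fderiv_fun_sum (fun i _ => (hf i).diff hU hx hy)]
  simp

lemma DD_comm (hU : IsOpen U) (hf : Sm U f) (u v : E n × E n) : EqOm U (DD u (DD v f)) (DD v (DD u f)) := by
  intro x hx y hy
  have h1 : ContDiffAt ℝ ∞ (fderiv ℝ (fun p : E n × E n => f p.1 p.2)) (x, y) :=
    ((ContDiffOn.fderiv_of_isOpen hf (isOpen_Om hU) (m := ∞) (by simp))).contDiffAt
      (Om_nhds hU hx hy)
  have h2 := (h1.differentiableAt (by simp))
  have key : ∀ a b : E n × E n, DD a (DD b f) x y =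
      fderiv ℝ (fderiv ℝ (fun p : E n × E n => f p.1 p.2)) (x, y) a b := by
    intro a b
    have := fderiv_clm_apply (𝕜 := ℝ) h2 (differentiableAt_const b)
    simp only [DD]
    simp [this]
  rw [key, key]
  have hs : IsSymmSndFDerivAt ℝ (fun p : E n × E n => f p.1 p.2) (x, y) :=
    (hf.contDiffAt hU hx hy).isSymmSndFDerivAt
      (by rw [minSmoothness_of_isRCLikeNormedField]; exact WithTop.coe_le_coe.2 le_top)
  exact hs.eq u v

lemma DD_coord (k : Fin n) (u : E n × E n) (x y : E n) :
    DD u (fun _ y => y k) x y = u.2 k := by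
  unfold DD
  have : (fun p : E n × E n => p.2 k) =
    ((ContinuousLinearMap.proj (R := ℝ) (φ := fun _ : Fin n => ℝ) k).comp
      (ContinuousLinearMap.snd ℝ (E n) (E n))) := rfl
  rw [this, ContinuousLinearMap.fderiv]
  rfl

lemma DD_lin (x y : E n) (f : E n → E n → ℝ) (a b : E n) :
    DD (a, b) f x y = ∑ i, a i * DD (e n i, 0) f x y + ∑ i, b i * DD (0, e n i) f x y := by
  have ha : ((a, b) : E n × E n) =
      ∑ i, a i • ((e n i, 0) : E n × E n) + ∑ i, b i • ((0, e n i) : E n × E n) := by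
    ext j
    · simp [Prod.fst_sum, e, Finset.sum_apply, Pi.single_apply]
    · simp [Prod.snd_sum, e, Finset.sum_apply, Pi.single_apply]
  unfold DD
  rw [ha]
  simp only [map_add, map_sum, map_smul, smul_eq_mul]

lemma pdy_congr (hU : IsOpen U) (hf : Sm U f) (hg : Sm U g) (h : EqOm U f g) (i : Fin n) :
    EqOm U (pdy n f i) (pdy n g i) := by
  intro x hx y hy
  rw [pdy_eq hU hf i x hx y hy, pdy_eq hU hg i x hx y hy, DD_congr hU h _ x hx y hy]

end

section
variable {n : ℕ} {U : Set (E n)} {F : E n → E n → ℝ}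

lemma smF (hF : IsFinsler n U F) : Sm U F := hF.smooth

lemma smF2 (hF : IsFinsler n U F) : Sm U (F2 n F) := by
  refine ((smF hF).mul (smF hF)).congr ?_
  intro x _ y _
  simp only [F2]; ring

lemma smgm (hU : IsOpen U) (hF : IsFinsler n U F) (i j : Fin n) : Sm U (gm n F i j) :=
  (Sm.const _).mul (((smF2 hF).pdy hU j).pdy hU i)

lemma sm_det {m : ℕ} {A : Fin m → Fin m → E n → E n → ℝ} (hA : ∀ i j, Sm U (A i j)) :
    Sm U (fun x y => (Matrix.of fun i j => A i j x y).det) := by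
  have : (fun x y => (Matrix.of fun i j => A i j x y).det) =
      fun x y => ∑ σ : Equiv.Perm (Fin m), ((Equiv.Perm.sign σ : ℤ) : ℝ) * ∏ i, A (σ i) i x y := by
    funext x y
    rw [Matrix.det_apply']
    rfl
  rw [this]
  exact Sm.sum fun σ => (Sm.const _).mul (Sm.prod fun i => hA _ _)

lemma smginv (hU : IsOpen U) (hF : IsFinsler n U F) (i j : Fin n) :
    Sm U (fun x y => ginv n F x y i j) := by
  have hdet : Sm U (fun x y => (gmat n F x y).det) := sm_det (smgm hU hF)
  have hadj : Sm U (fun x y => (gmat n F x y).adjugate i j) := by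
    have h := sm_det (U := U) (n := n)
      (A := fun a b => if a = j then (fun _ _ => (Pi.single i 1 : Fin n → ℝ) b) else gm n F a b) (by
        intro a b
        by_cases h : a = j
        · simp only [h, if_true]; exact Sm.const _
        · simp only [h, if_false]; exact smgm hU hF _ _)
    refine h.congr ?_
    intro x _ y _
    change (gmat n F x y).adjugate i j = _
    rw [Matrix.adjugate_apply]
    congr 1
    ext a b
    by_cases h : a = j
    · subst h; simp
    · simp [h, gmat]
  have hinv : Sm U (fun x y => ((gmat n F x y).det)⁻¹) :=
    ContDiffOn.inv hdet (fun p hp => (hF.posdef p.1 hp.1 p.2 hp.2).det_pos.ne')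
  refine (hinv.mul hadj).congr ?_
  intro x _ y _
  simp [ginv, Matrix.inv_def]

lemma smSpray (hU : IsOpen U) (hF : IsFinsler n U F) (i : Fin n) : Sm U (Spray n F i) := by
  refine (Sm.const _).mul (Sm.sum fun l => (smginv hU hF i l).mul ?_)
  exact (Sm.sum fun k => (((smF2 hF).pdy hU l).pdx hU k).mul (Sm.coord k)).sub ((smF2 hF).pdx hU l)

lemma gm_symm (hU : IsOpen U) (hF : IsFinsler n U F) (i j : Fin n) :
    EqOm U (gm n F i j) (gm n F j i) := by
  intro x hx y hy
  have h := smF2 hF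
  simp only [gm]
  rw [pdy_eq hU (h.pdy hU j) i x hx y hy, pdy_eq hU (h.pdy hU i) j x hx y hy,
    DD_congr hU (pdy_eq hU h j) _ x hx y hy, DD_congr hU (pdy_eq hU h i) _ x hx y hy,
    DD_comm hU h _ _ x hx y hy]

/-- Euler-Lagrange -/
lemma EL (hF : IsFinsler n U F) (l : Fin n) :
    EqOm U (fun x y => 4 * ∑ m, gm n F l m x y * Spray n F m x y)
      (fun x y => (∑ k, pdx n (pdy n (F2 n F) l) k x y * y k) - pdx n (F2 n F) l x y) := by
  intro x hx y hy
  have hdet : IsUnit (gmat n F x y).det := (hF.posdef x hx y hy).det_pos.ne'.isUnit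
  set V : Fin n → ℝ := fun l => (∑ k, pdx n (pdy n (F2 n F) l) k x y * y k) - pdx n (F2 n F) l x y
    with hV
  have h1 : ∀ m, Spray n F m x y = (1 / 4) * (ginv n F x y).mulVec V m := fun m => rfl
  have h2 : (gmat n F x y).mulVec ((ginv n F x y).mulVec V) = V := by
    rw [Matrix.mulVec_mulVec, ginv, Matrix.mul_nonsing_inv _ hdet, Matrix.one_mulVec]
  have h3 := congrFun h2 l
  change _ = V l
  rw [← h3]
  simp only [h1, Finset.mul_sum, Matrix.mulVec, dotProduct, gmat, Matrix.of_apply]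
  refine Finset.sum_congr rfl fun m _ => Finset.sum_congr rfl fun k _ => by ring

/-- shorthand: base derivative -/
def bx (n : ℕ) (i : Fin n) : E n × E n := (e n i, 0)
/-- shorthand: fibre derivative -/
def fy (n : ℕ) (i : Fin n) : E n × E n := (0, e n i)

lemma gm_DD (hU : IsOpen U) (hF : IsFinsler n U F) (i j : Fin n) :
    EqOm U (gm n F i j) (fun x y => (1 / 2) * DD (fy n i) (DD (fy n j) (F2 n F)) x y) := by
  intro x hx y hy
  simp only [gm]
  rw [pdy_eq hU ((smF2 hF).pdy hU j) i x hx y hy, DD_congr hU (pdy_eq hU (smF2 hF) j) _ x hx y hy]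
  rfl

/-- Euler-Lagrange in DD form -/
lemma EL' (hU : IsOpen U) (hF : IsFinsler n U F) (l : Fin n) :
    EqOm U (fun x y => 4 * ∑ m, gm n F l m x y * Spray n F m x y)
      (fun x y => (∑ k, y k * DD (bx n k) (DD (fy n l) (F2 n F)) x y)
        - DD (bx n l) (F2 n F) x y) := by
  intro x hx y hy
  rw [EL hF l x hx y hy]
  have h := smF2 hF
  refine congrArg₂ (fun a b : ℝ => a - b) ?_ ?_
  · refine Finset.sum_congr rfl fun k _ => ?_
    rw [pdx_eq hU (h.pdy hU l) k x hx y hy, DD_congr hU (pdy_eq hU h l) _ x hx y hy, mul_comm]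
    rfl
  · exact pdx_eq hU h l x hx y hy

/-- derivative of EL in an arbitrary direction -/
lemma EL_diff (hU : IsOpen U) (hF : IsFinsler n U F) (l : Fin n) (u : E n × E n)
    {x y : E n} (hx : x ∈ U) (hy : y ≠ 0) :
    4 * ∑ m, (DD u (gm n F l m) x y * Spray n F m x y + gm n F l m x y * DD u (Spray n F m) x y)
      = (∑ k, (u.2 k * DD (bx n k) (DD (fy n l) (F2 n F)) x y
          + y k * DD u (DD (bx n k) (DD (fy n l) (F2 n F))) x y))
        - DD u (DD (bx n l) (F2 n F)) x y := by
  have h := smF2 hF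
  have hg := smgm hU hF
  have hS := smSpray hU hF
  have h1 := DD_congr hU (EL' hU hF l) u x hx y hy
  rw [DD_cmul hU (Sm.sum fun m => (hg l m).mul (hS m)) 4 u x hx y hy,
    DD_sum hU (fun m => (hg l m).mul (hS m)) u x hx y hy,
    DD_sub hU (Sm.sum fun k => (Sm.coord k).mul ((h.DD hU _).DD hU _)) (h.DD hU _) u x hx y hy,
    DD_sum hU (fun k => (Sm.coord k).mul ((h.DD hU _).DD hU _)) u x hx y hy] at h1
  have i1 : ∑ m, (DD u (gm n F l m) x y * Spray n F m x y + gm n F l m x y * DD u (Spray n F m) x y)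
      = ∑ m, DD u (fun x y => gm n F l m x y * Spray n F m x y) x y :=
    Finset.sum_congr rfl fun m _ => (DD_mul hU (hg l m) (hS m) u x hx y hy).symm
  have i2 : ∑ k, (u.2 k * DD (bx n k) (DD (fy n l) (F2 n F)) x y
          + y k * DD u (DD (bx n k) (DD (fy n l) (F2 n F))) x y)
      = ∑ k, DD u (fun x y => y k * DD (bx n k) (DD (fy n l) (F2 n F)) x y) x y :=
    Finset.sum_congr rfl fun m _ => by
      rw [DD_mul hU (Sm.coord m) ((h.DD hU _).DD hU _) u x hx y hy, DD_coord]
  rw [i1, i2]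
  exact h1

/-- the spray derivative as a directional derivative -/
def SS (n : ℕ) (F : E n → E n → ℝ) (x y : E n) : E n × E n :=
  (y, fun i => -2 * Spray n F i x y)

lemma SS_apply (f : E n → E n → ℝ) (x y : E n) :
    DD (SS n F x y) f x y = ∑ i, y i * DD (bx n i) f x y
      - 2 * ∑ i, Spray n F i x y * DD (fy n i) f x y := by
  rw [SS, DD_lin, Finset.mul_sum, sub_eq_add_neg, ← Finset.sum_neg_distrib]
  congr 1
  refine Finset.sum_congr rfl fun i _ => ?_
  simp only [fy]; ring

lemma e_apply_sum (j : Fin n) (c : Fin n → ℝ) : ∑ k, e n j k * c k = c j := by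
  simp [e, Pi.single_apply]

/-- third derivatives commute conveniently -/
lemma DDD_comm (hU : IsOpen U) {f : E n → E n → ℝ} (hf : Sm U f) (u v w : E n × E n) :
    EqOm U (DD u (DD v (DD w f))) (DD w (DD u (DD v f))) := by
  intro x hx y hy
  rw [DD_congr hU (DD_comm hU hf v w) u x hx y hy, DD_comm hU (hf.DD hU v) u w x hx y hy]

/-- `4 g_{lm} N^m_j = 2 S(g_{lj}) + Q_{x^j y^l} - Q_{x^l y^j}` -/
lemma eqB (hU : IsOpen U) (hF : IsFinsler n U F) (l j : Fin n)
    {x y : E n} (hx : x ∈ U) (hy : y ≠ 0) :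
    4 * ∑ m, gm n F l m x y * DD (fy n j) (Spray n F m) x y
      = 2 * DD (SS n F x y) (gm n F l j) x y
        + DD (bx n j) (DD (fy n l) (F2 n F)) x y - DD (bx n l) (DD (fy n j) (F2 n F)) x y := by
  have h := smF2 hF
  have h1 := EL_diff hU hF l (fy n j) hx hy
  rw [Finset.sum_add_distrib, Finset.sum_add_distrib] at h1
  have h2 : ∑ k, (fy n j).2 k * DD (bx n k) (DD (fy n l) (F2 n F)) x y
      = DD (bx n j) (DD (fy n l) (F2 n F)) x y := e_apply_sum j _
  have h3 : ∀ u, DD u (gm n F l j) x y = (1/2) * DD u (DD (fy n l) (DD (fy n j) (F2 n F))) x y := by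
    intro u
    rw [DD_congr hU (gm_DD hU hF l j) u x hx y hy, DD_cmul hU ((h.DD hU _).DD hU _) _ _ x hx y hy]
  have h4 : ∀ k, DD (fy n j) (DD (bx n k) (DD (fy n l) (F2 n F))) x y =
      2 * DD (bx n k) (gm n F l j) x y := by
    intro k
    rw [h3, DD_comm hU (h.DD hU _) _ _ x hx y hy, DD_congr hU (DD_comm hU h _ _) _ x hx y hy]
    ring
  have h5 : ∀ m, DD (fy n j) (gm n F l m) x y = DD (fy n m) (gm n F l j) x y := by
    intro m
    rw [h3, DD_congr hU (gm_DD hU hF l m) _ x hx y hy, DD_cmul hU ((h.DD hU _).DD hU _) _ _ x hx y hy,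
      DDD_comm hU h (fy n j) (fy n l) (fy n m) x hx y hy,
      DD_congr hU (DD_comm hU h (fy n j) (fy n l)) _ x hx y hy]
  rw [h2] at h1
  simp only [h4, h5] at h1
  rw [SS_apply]
  rw [DD_comm hU h (bx n l) (fy n j) x hx y hy]
  have h6 : ∑ k, y k * (2 * DD (bx n k) (gm n F l j) x y)
      = 2 * ∑ k, y k * DD (bx n k) (gm n F l j) x y := by
    rw [Finset.mul_sum]; exact Finset.sum_congr rfl fun _ _ => by ring
  have h7 : ∑ m, DD (fy n m) (gm n F l j) x y * Spray n F m x y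
      = ∑ m, Spray n F m x y * DD (fy n m) (gm n F l j) x y :=
    Finset.sum_congr rfl fun _ _ => mul_comm _ _
  rw [h6, h7] at h1
  linarith

/-- `4 g_{lm} G^m_{x^k} = S(Q_{x^k y^l}) - Q_{x^k x^l}` -/
lemma eqX (hU : IsOpen U) (hF : IsFinsler n U F) (l k : Fin n)
    {x y : E n} (hx : x ∈ U) (hy : y ≠ 0) :
    4 * ∑ m, gm n F l m x y * DD (bx n k) (Spray n F m) x y
      = DD (SS n F x y) (DD (bx n k) (DD (fy n l) (F2 n F))) x y
        - DD (bx n k) (DD (bx n l) (F2 n F)) x y := by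
  have h := smF2 hF
  have h1 := EL_diff hU hF l (bx n k) hx hy
  rw [Finset.sum_add_distrib, Finset.sum_add_distrib] at h1
  have h2 : ∑ m, (bx n k).2 m * DD (bx n m) (DD (fy n l) (F2 n F)) x y = 0 := by
    simp [bx]
  have h3 : ∀ u m, DD u (gm n F l m) x y =
      (1/2) * DD u (DD (fy n l) (DD (fy n m) (F2 n F))) x y := by
    intro u m
    rw [DD_congr hU (gm_DD hU hF l m) u x hx y hy, DD_cmul hU ((h.DD hU _).DD hU _) _ _ x hx y hy]
  have h4 : ∀ m, DD (bx n k) (DD (bx n m) (DD (fy n l) (F2 n F))) x y =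
      DD (bx n m) (DD (bx n k) (DD (fy n l) (F2 n F))) x y := by
    intro m
    rw [DD_comm hU (h.DD hU _) _ _ x hx y hy]
  have h5 : ∀ m, DD (bx n k) (gm n F l m) x y =
      (1/2) * DD (fy n m) (DD (bx n k) (DD (fy n l) (F2 n F))) x y := by
    intro m
    rw [h3, DDD_comm hU h _ _ _ x hx y hy]
  rw [h2] at h1
  simp only [h4, h5] at h1
  rw [SS_apply]
  have h7 : ∑ m, 1 / 2 * DD (fy n m) (DD (bx n k) (DD (fy n l) (F2 n F))) x y * Spray n F m x y
      = (1 / 2) * ∑ m, Spray n F m x y * DD (fy n m) (DD (bx n k) (DD (fy n l) (F2 n F))) x y := by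
    rw [Finset.mul_sum]; exact Finset.sum_congr rfl fun _ _ => by ring
  rw [h7] at h1
  linarith

/-- Riemann curvature in DD form -/
lemma RiemUp_eq (hU : IsOpen U) (hF : IsFinsler n U F) (i k : Fin n)
    {x y : E n} (hx : x ∈ U) (hy : y ≠ 0) :
    RiemUp n F i k x y = 2 * DD (bx n k) (Spray n F i) x y
      - DD (SS n F x y) (DD (fy n k) (Spray n F i)) x y
      - ∑ j, DD (fy n j) (Spray n F i) x y * DD (fy n k) (Spray n F j) x y := by
  have hS := smSpray hU hF
  have a1 : ∀ i k, pdx n (Spray n F i) k x y = DD (bx n k) (Spray n F i) x y :=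
    fun i k => pdx_eq hU (hS i) k x hx y hy
  have a2 : ∀ i k, pdy n (Spray n F i) k x y = DD (fy n k) (Spray n F i) x y :=
    fun i k => pdy_eq hU (hS i) k x hx y hy
  have a3 : ∀ j, pdx n (pdy n (Spray n F i) k) j x y =
      DD (bx n j) (DD (fy n k) (Spray n F i)) x y := by
    intro j
    rw [pdx_eq hU ((hS i).pdy hU k) j x hx y hy]
    exact DD_congr hU (pdy_eq hU (hS i) k) _ x hx y hy
  have a4 : ∀ j, pdy n (pdy n (Spray n F i) k) j x y =
      DD (fy n j) (DD (fy n k) (Spray n F i)) x y := by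
    intro j
    rw [pdy_eq hU ((hS i).pdy hU k) j x hx y hy]
    exact DD_congr hU (pdy_eq hU (hS i) k) _ x hx y hy
  simp only [RiemUp, a1, a2, a3, a4]
  rw [SS_apply]
  ring

lemma Rlow_symm (hU : IsOpen U) (hF : IsFinsler n U F) (l k : Fin n) :
    EqOm U (Rlow n F l k) (Rlow n F k l) := by
  intro x hx y hy
  have h := smF2 hF
  have hS := smSpray hU hF
  have hg := smgm hU hF
  set s := SS n F x y with hs
  set N : Fin n → Fin n → ℝ := fun i j => DD (fy n j) (Spray n F i) x y with hN
  set G : Fin n → Fin n → ℝ := fun i j => gm n F i j x y with hG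
  have Gs : ∀ i j, G i j = G j i := fun i j => gm_symm hU hF i j x hx y hy
  -- derivative of `g` along the spray
  have c1 : ∀ l j, DD s (gm n F l j) x y = ∑ m, G l m * N m j + ∑ m, G j m * N m l := by
    intro l j
    have e1 := eqB hU hF l j hx hy
    have e2 := eqB hU hF j l hx hy
    have e3 := DD_congr hU (gm_symm hU hF l j) s x hx y hy
    rw [← hs] at e1 e2
    simp only [hG, hN]
    linarith
  -- skew part of `B`
  have c2 : ∀ l j, EqOm U (fun x y => 2 * (∑ m, gm n F l m x y * DD (fy n j) (Spray n F m) x y -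
        ∑ m, gm n F j m x y * DD (fy n l) (Spray n F m) x y))
      (fun x y => DD (bx n j) (DD (fy n l) (F2 n F)) x y
        - DD (bx n l) (DD (fy n j) (F2 n F)) x y) := by
    intro l j x hx y hy
    have e1 := eqB hU hF l j hx hy
    have e2 := eqB hU hF j l hx hy
    have e3 := DD_congr hU (gm_symm hU hF l j) (SS n F x y) x hx y hy
    simp only
    linarith
  -- its derivative along the spray
  have smB : ∀ l j, Sm U (fun x y => ∑ m, gm n F l m x y * DD (fy n j) (Spray n F m) x y) :=
    fun l j => Sm.sum fun m => (hg l m).mul ((hS m).DD hU _)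
  have c3 : ∀ l j, DD s (fun x y => ∑ m, gm n F l m x y * DD (fy n j) (Spray n F m) x y) x y
      = ∑ m, DD s (gm n F l m) x y * N m j + ∑ m, G l m * DD s (DD (fy n j) (Spray n F m)) x y := by
    intro l j
    rw [DD_sum hU (fun m => (hg l m).mul ((hS m).DD hU _)) s x hx y hy, ← Finset.sum_add_distrib]
    refine Finset.sum_congr rfl fun m _ => ?_
    rw [DD_mul hU (hg l m) ((hS m).DD hU _) s x hx y hy]
  have c4 := DD_congr hU (c2 l k) s x hx y hy
  rw [DD_cmul hU ((smB l k).sub (smB k l)) 2 s x hx y hy, DD_sub hU (smB l k) (smB k l) s x hx y hy,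
    DD_sub hU ((h.DD hU _).DD hU _) ((h.DD hU _).DD hU _) s x hx y hy, c3, c3] at c4
  have x1 := eqX hU hF l k hx hy
  have x2 := eqX hU hF k l hx hy
  have x3 := DD_comm hU h (bx n k) (bx n l) x hx y hy
  -- expand `Rlow`
  have r : ∀ l k, Rlow n F l k x y = 2 * ∑ m, gm n F l m x y * DD (bx n k) (Spray n F m) x y
      - ∑ m, G l m * DD s (DD (fy n k) (Spray n F m)) x y
      - ∑ m, ∑ j, G l m * (N m j * N j k) := by
    intro l k
    simp only [Rlow]
    rw [Finset.mul_sum, ← Finset.sum_sub_distrib, ← Finset.sum_sub_distrib]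
    refine Finset.sum_congr rfl fun m _ => ?_
    rw [RiemUp_eq hU hF m k hx hy, ← Finset.mul_sum, gm_symm hU hF m l x hx y hy]
    simp only [hG, hN, hs]
    ring
  have q : ∀ l k, ∑ m, DD s (gm n F l m) x y * N m k
      = ∑ m, ∑ j, G l m * (N m j * N j k) + ∑ m, ∑ j, N m l * G m j * N j k := by
    intro l k
    simp only [c1, add_mul, Finset.sum_add_distrib, Finset.sum_mul]
    congr 1
    · rw [Finset.sum_comm]
      refine Finset.sum_congr rfl fun m _ => Finset.sum_congr rfl fun j _ => by ring
    · rw [Finset.sum_comm]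
      refine Finset.sum_congr rfl fun m _ => Finset.sum_congr rfl fun j _ => by
        rw [Gs j m]; ring
  have q' : ∑ m, ∑ j, N m l * G m j * N j k = ∑ m, ∑ j, N m k * G m j * N j l := by
    rw [Finset.sum_comm]
    refine Finset.sum_congr rfl fun m _ => Finset.sum_congr rfl fun j _ => by
        rw [Gs j m]; ring
  rw [r l k, r k l]
  rw [q l k, q k l, q'] at c4
  rw [← hs] at x1 x2
  linarith

end

section algebra

variable {V : Type*} [AddCommGroup V] [Module ℝ V]

lemma poly5 (a0 a1 a2 a3 a4 a5 : ℝ)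
    (h : ∀ s : ℝ, a0 + a1 * s + a2 * s ^ 2 + a3 * s ^ 3 + a4 * s ^ 4 + a5 * s ^ 5 = 0) :
    a0 = 0 ∧ a1 = 0 ∧ a2 = 0 ∧ a3 = 0 ∧ a4 = 0 ∧ a5 = 0 := by
  have h0 := h 0
  have h1 := h 1
  have h2 := h (-1)
  have h3 := h 2
  have h4 := h (-2)
  have h5 := h 3
  norm_num at h0 h1 h2 h3 h4 h5
  refine ⟨?_, ?_, ?_, ?_, ?_, ?_⟩ <;> linarith

/-- the division step: for every `w` orthogonal to `a` the two remainders multiply to zero -/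
lemma division_step (h R : V →ₗ[ℝ] V →ₗ[ℝ] ℝ) (C T : V →ₗ[ℝ] V →ₗ[ℝ] V →ₗ[ℝ] ℝ)
    (hs : ∀ u v, h u v = h v u) (Rs : ∀ u v, R u v = R v u)
    (C1 : ∀ u v w, C u v w = C v u w) (C2 : ∀ u v w, C u v w = C u w v)
    (hT : ∀ v, T v v v * h v v = 2 * C v v v * R v v)
    (a : V) (ha : h a a = 1) (w : V) (hw : h a w = 0) :
    ((R w w - R a a * h w w) ^ 2 + h w w * (2 * R a w) ^ 2) * (3 * C a w w - C a a a * h w w) = 0 ∧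
    ((R w w - R a a * h w w) ^ 2 + h w w * (2 * R a w) ^ 2) * (C w w w - 3 * C a a w * h w w) = 0 := by
  have hw' : h w a = 0 := by rw [hs, hw]
  have key : ∀ s : ℝ,
      (T w w w * h w w - 2 * C w w w * R w w)
      + ((T a w w + T w a w + T w w a) * h w w - 2 * (3 * C a w w * R w w + C w w w * (2 * R a w))) * s
      + (T w w w + (T a a w + T a w a + T w a a) * h w w
          - 2 * (3 * C a a w * R w w + 3 * C a w w * (2 * R a w) + C w w w * R a a)) * s ^ 2
      + ((T a w w + T w a w + T w w a) + T a a a * h w w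
          - 2 * (C a a a * R w w + 3 * C a a w * (2 * R a w) + 3 * C a w w * R a a)) * s ^ 3
      + ((T a a w + T a w a + T w a a) - 2 * (C a a a * (2 * R a w) + 3 * C a a w * R a a)) * s ^ 4
      + (T a a a - 2 * (C a a a * R a a)) * s ^ 5 = 0 := by
    intro s
    have e := hT (s • a + w)
    simp only [map_add, map_smul, LinearMap.add_apply, LinearMap.smul_apply, smul_eq_mul, ha, hw,
      hw', Rs w a, C1 w a w, C2 a w a, C2 w w a, C1 w a a] at e
    linear_combination e
  obtain ⟨p0, p1, p2, p3, p4, p5⟩ := poly5 _ _ _ _ _ _ key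
  set q := h w w
  have A : (R w w - R a a * q) * (C w w w - 3 * C a a w * q)
      = q * (2 * R a w) * (3 * C a w w - C a a a * q) := by
    linear_combination (-1 / 2) * (p0 - q * p2 + q ^ 2 * p4)
  have B : (2 * R a w) * (C w w w - 3 * C a a w * q)
      + (R w w - R a a * q) * (3 * C a w w - C a a a * q) = 0 := by
    linear_combination (-1 / 2) * (p1 - q * p3 + q ^ 2 * p5)
  constructor
  · linear_combination (R w w - R a a * q) * B - (2 * R a w) * A
  · linear_combination (R w w - R a a * q) * A + q * (2 * R a w) * B

lemma exists_small (f : ℝ → ℝ) (hf : Continuous f) (h0 : f 0 ≠ 0) :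
    ∃ d : ℝ, 0 < d ∧ f d ≠ 0 ∧ f (-d) ≠ 0 ∧ f (d / 2) ≠ 0 ∧ f (-(d / 2)) ≠ 0 := by
  have : ∀ᶠ t in nhds (0 : ℝ), f t ≠ 0 := hf.continuousAt.eventually_ne h0
  obtain ⟨r, hr, H⟩ := Metric.eventually_nhds_iff.1 this
  refine ⟨r / 2, by positivity, ?_, ?_, ?_, ?_⟩ <;> apply H <;> rw [Real.dist_eq, abs_lt] <;>
    constructor <;> linarith

lemma alg_main (h R : V →ₗ[ℝ] V →ₗ[ℝ] ℝ) (C T : V →ₗ[ℝ] V →ₗ[ℝ] V →ₗ[ℝ] ℝ)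
    (hs : ∀ u v, h u v = h v u) (Rs : ∀ u v, R u v = R v u)
    (C1 : ∀ u v w, C u v w = C v u w) (C2 : ∀ u v w, C u v w = C u w v)
    (hT : ∀ v, T v v v * h v v = 2 * C v v v * R v v)
    (hnn : ∀ u, 0 ≤ h u u) (hker : ∀ u, h u u = 0 → ∀ v, h u v = 0)
    (a : V) (ha : h a a = 1) (w1 : V) (hw1 : h a w1 = 0) (hw1' : 0 < h w1 w1) :
    (∀ u v, R u v = R a a * h u v) ∨
    (∀ u v w, 3 * C u v w = h u v * (3 * C a a w - 2 * C a a a * h a w)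
      + h v w * (3 * C a a u - 2 * C a a a * h a u)
      + h w u * (3 * C a a v - 2 * C a a a * h a v)) := by
  have D := division_step h R C T hs Rs C1 C2 hT a ha
  have dec : ∀ v, ∃ (s : ℝ) (w : V), v = s • a + w ∧ h a w = 0 := fun v =>
    ⟨h a v, v - h a v • a, by abel, by simp [ha]⟩
  by_cases hc : ∀ w, h a w = 0 → h w w ≠ 0 →
      (R w w - R a a * h w w) ^ 2 + h w w * (2 * R a w) ^ 2 = 0
  · left
    have g1 : ∀ w, h a w = 0 → h w w ≠ 0 → R w w = R a a * h w w ∧ R a w = 0 := by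
      intro w hw hw0
      have hp : 0 < h w w := lt_of_le_of_ne (hnn w) (Ne.symm hw0)
      have e := hc w hw hw0
      have e1 : (R w w - R a a * h w w) ^ 2 = 0 := by
        have := sq_nonneg (R w w - R a a * h w w)
        have := mul_nonneg hp.le (sq_nonneg (2 * R a w))
        linarith
      have e2 : h w w * (2 * R a w) ^ 2 = 0 := by linarith
      constructor
      · have := pow_eq_zero_iff (two_ne_zero) |>.1 e1
        linarith
      · have := (mul_eq_zero.1 e2).resolve_left hw0
        have := pow_eq_zero_iff (two_ne_zero) |>.1 this
        linarith
    have g2 : ∀ w, h a w = 0 → R w w = R a a * h w w ∧ R a w = 0 := by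
      intro w hw
      by_cases hw0 : h w w = 0
      · have k := hker w hw0 w1
        have k' : h w1 w = 0 := by rw [hs, k]
        obtain ⟨b1, b2⟩ := g1 w1 hw1 hw1'.ne'
        obtain ⟨d1, d2⟩ := g1 (w + w1) (by simp [hw, hw1]) (by simp [hw0, k, k', hw1'.ne'])
        obtain ⟨f1, f2⟩ := g1 (w - w1) (by simp [hw, hw1]) (by simp [hw0, k, k', hw1'.ne'])
        simp only [map_add, map_sub, LinearMap.add_apply, LinearMap.sub_apply] at d1 d2 f1 f2
        rw [hw0, k, k'] at d1 f1
        constructor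
        · rw [hw0]; linarith
        · linarith
      · exact g1 w hw hw0
    have g3 : ∀ v, R v v = R a a * h v v := by
      intro v
      obtain ⟨s, w, rfl, hw⟩ := dec v
      obtain ⟨b1, b2⟩ := g2 w hw
      simp only [map_add, map_smul, LinearMap.add_apply, LinearMap.smul_apply, smul_eq_mul, ha, hw,
        hs w a, Rs w a, b1, b2]
      ring
    intro u v
    have e := g3 (u + v)
    simp only [map_add, LinearMap.add_apply] at e
    rw [hs v u, Rs v u] at e
    linarith [g3 u, g3 v]
  · right
    push Not at hc
    obtain ⟨w0, hw0, _, hN⟩ := hc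
    have g : ∀ w, h a w = 0 → 3 * C a w w - C a a a * h w w = 0 ∧ C w w w - 3 * C a a w * h w w = 0 := by
      intro w hw
      set f : ℝ → ℝ := fun t => (R (w0 + t • w) (w0 + t • w) - R a a * h (w0 + t • w) (w0 + t • w)) ^ 2
        + h (w0 + t • w) (w0 + t • w) * (2 * R a (w0 + t • w)) ^ 2 with hf
      have hfc : Continuous f := by
        simp only [hf, map_add, map_smul, LinearMap.add_apply, LinearMap.smul_apply, smul_eq_mul]
        fun_prop
      obtain ⟨d, hd, d1, d2, d3, d4⟩ := exists_small f hfc (by simpa [hf] using hN)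
      have k : ∀ t : ℝ, f t ≠ 0 →
          3 * C a (w0 + t • w) (w0 + t • w) - C a a a * h (w0 + t • w) (w0 + t • w) = 0 ∧
          C (w0 + t • w) (w0 + t • w) (w0 + t • w)
            - 3 * C a a (w0 + t • w) * h (w0 + t • w) (w0 + t • w) = 0 := by
        intro t ht
        obtain ⟨x1, x2⟩ := D (w0 + t • w) (by simp [hw0, hw])
        exact ⟨(mul_eq_zero.1 x1).resolve_left ht, (mul_eq_zero.1 x2).resolve_left ht⟩
      obtain ⟨a1, b1⟩ := k _ d1
      obtain ⟨a2, b2⟩ := k _ d2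
      obtain ⟨a3, b3⟩ := k _ d3
      obtain ⟨a4, b4⟩ := k _ d4
      simp only [map_add, map_smul, LinearMap.add_apply, LinearMap.smul_apply, smul_eq_mul]
        at a1 a2 a3 a4 b1 b2 b3 b4
      constructor
      · have : d ^ 2 * (3 * C a w w - C a a a * h w w) = 0 := by
          linear_combination (2 / 3) * (a1 + a2 - a3 - a4)
        exact (mul_eq_zero.1 this).resolve_left (by positivity)
      · have : d ^ 3 * (C w w w - 3 * C a a w * h w w) = 0 := by
          linear_combination (2 / 3) * (b1 - b2) - (4 / 3) * (b3 - b4)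
        exact (mul_eq_zero.1 this).resolve_left (by positivity)
    have g3 : ∀ v, C v v v = h v v * (3 * C a a v - 2 * C a a a * h a v) := by
      intro v
      obtain ⟨s, w, rfl, hw⟩ := dec v
      obtain ⟨b1, b2⟩ := g w hw
      simp only [map_add, map_smul, LinearMap.add_apply, LinearMap.smul_apply, smul_eq_mul, ha, hw,
        hs w a, C1 w a w, C2 a w a, C2 w w a, C1 w a a]
      linear_combination s * b1 + b2
    intro u v w
    have e1 := g3 (u + v + w)
    have e2 := g3 (u + v)
    have e3 := g3 (v + w)
    have e4 := g3 (u + w)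
    simp only [map_add, LinearMap.add_apply] at e1 e2 e3 e4
    simp only [hs v u, hs w u, hs w v, C1 v u, C1 w u, C1 w v, C2 _ v u, C2 _ w u, C2 _ w v]
      at e1 e2 e3 e4 ⊢
    linear_combination (1 / 2) * (e1 - e2 - e3 - e4 + g3 u + g3 v + g3 w)

end algebra

section trace

lemma trace_step {n : ℕ} (g Gi h : Fin n → Fin n → ℝ) (C : Fin n → Fin n → Fin n → ℝ)
    (f y θ : Fin n → ℝ) (F : ℝ) (hF : F ≠ 0)
    (gs : ∀ i j, g i j = g j i)
    (i1 : ∀ i k, ∑ j, g i j * Gi j k = if i = k then 1 else 0)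
    (i2 : ∀ i k, ∑ j, Gi i j * g j k = if i = k then 1 else 0)
    (hh : ∀ i j, h i j = g i j - f i * f j)
    (hgy : ∀ j, ∑ m, y m * g m j = F * f j) (hfy : ∑ j, y j * f j = F)
    (hθ : ∑ k, y k * θ k = 0)
    (hC : ∀ i j k, 3 * C i j k = h i j * θ k + h j k * θ i + h k i * θ j) (i : Fin n) :
    3 * ∑ j, ∑ k, Gi j k * C i j k = ((n : ℝ) + 1) * θ i := by
  have fe : ∀ j, f j = (∑ m, y m * g m j) / F := fun j => by rw [hgy]; field_simp
  have a1 : ∀ k, ∑ j, f j * Gi j k = y k / F := by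
    intro k
    simp only [fe, div_mul_eq_mul_div, Finset.sum_mul, ← Finset.sum_div]
    rw [Finset.sum_comm]
    congr 1
    have : ∀ m, ∑ j, y m * g m j * Gi j k = y m * if m = k then 1 else 0 := by
      intro m; rw [← i1, Finset.mul_sum]; exact Finset.sum_congr rfl fun _ _ => by ring
    simp [this]
  have a2 : ∀ j, ∑ k, Gi j k * f k = y j / F := by
    intro j
    simp only [fe, mul_div_assoc', Finset.mul_sum, ← Finset.sum_div]
    rw [Finset.sum_comm]
    congr 1
    have : ∀ m, ∑ k, Gi j k * (y m * g m k) = y m * if j = m then 1 else 0 := by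
      intro m; rw [← i2, Finset.mul_sum]
      exact Finset.sum_congr rfl fun k _ => by rw [gs m k]; ring
    simp [this]
  have H1 : ∀ i k, ∑ j, h i j * Gi j k = (if i = k then 1 else 0) - f i * (y k / F) := by
    intro i k
    rw [← i1, ← a1, Finset.mul_sum, ← Finset.sum_sub_distrib]
    exact Finset.sum_congr rfl fun j _ => by rw [hh]; ring
  have H2 : ∀ j i, ∑ k, Gi j k * h k i = (if j = i then 1 else 0) - (y j / F) * f i := by
    intro j i
    rw [← i2, ← a2, Finset.sum_mul, ← Finset.sum_sub_distrib]
    exact Finset.sum_congr rfl fun k _ => by rw [hh]; ring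
  have t1 : ∑ j, ∑ k, Gi j k * (h i j * θ k) = θ i := by
    rw [Finset.sum_comm]
    have : ∀ k, ∑ j, Gi j k * (h i j * θ k)
        = (if i = k then 1 else 0) * θ k - f i / F * (y k * θ k) := by
      intro k
      have e : ∑ j, Gi j k * (h i j * θ k) = (∑ j, h i j * Gi j k) * θ k := by
        rw [Finset.sum_mul]; exact Finset.sum_congr rfl fun _ _ => by ring
      rw [e, H1]; ring
    simp only [this, Finset.sum_sub_distrib, ← Finset.mul_sum, hθ]
    simp
  have t3 : ∑ j, ∑ k, Gi j k * (h k i * θ j) = θ i := by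
    have : ∀ j, ∑ k, Gi j k * (h k i * θ j)
        = (if j = i then 1 else 0) * θ j - f i / F * (y j * θ j) := by
      intro j
      have e : ∑ k, Gi j k * (h k i * θ j) = (∑ k, Gi j k * h k i) * θ j := by
        rw [Finset.sum_mul]; exact Finset.sum_congr rfl fun _ _ => by ring
      rw [e, H2]; ring
    simp only [this, Finset.sum_sub_distrib, ← Finset.mul_sum, hθ]
    simp
  have t2 : ∑ j, ∑ k, Gi j k * (h j k * θ i) = ((n : ℝ) - 1) * θ i := by
    have : ∀ j, ∑ k, Gi j k * (h j k * θ i) = (1 - (y j * f j) / F) * θ i := by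
      intro j
      have e : ∑ k, Gi j k * (h j k * θ i) = (∑ k, Gi j k * h k j) * θ i := by
        rw [Finset.sum_mul]
        exact Finset.sum_congr rfl fun k _ => by rw [hh, hh, gs j k]; ring
      rw [e, H2]; simp; left; ring
    simp only [this, ← Finset.sum_mul, Finset.sum_sub_distrib, ← Finset.sum_div, hfy]
    simp [hF]
  have e : 3 * ∑ j, ∑ k, Gi j k * C i j k = ∑ j, ∑ k, Gi j k * (h i j * θ k)
      + ∑ j, ∑ k, Gi j k * (h j k * θ i) + ∑ j, ∑ k, Gi j k * (h k i * θ j) := by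
    simp only [Finset.mul_sum, ← Finset.sum_add_distrib]
    refine Finset.sum_congr rfl fun j _ => Finset.sum_congr rfl fun k _ => ?_
    linear_combination Gi j k * hC i j k
  rw [e, t1, t2, t3]; ring

end trace

section forms
variable {n : ℕ}

/-- the bilinear form of a matrix -/
def bil (M : Fin n → Fin n → ℝ) : E n →ₗ[ℝ] E n →ₗ[ℝ] ℝ :=
  ∑ j, (LinearMap.proj (R := ℝ) (φ := fun _ : Fin n => ℝ) j).smulRight
    (∑ k, M j k • (LinearMap.proj (R := ℝ) (φ := fun _ : Fin n => ℝ) k : E n →ₗ[ℝ] ℝ))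

/-- the trilinear form of a 3-array -/
def tri (M : Fin n → Fin n → Fin n → ℝ) : E n →ₗ[ℝ] E n →ₗ[ℝ] E n →ₗ[ℝ] ℝ :=
  ∑ i, (LinearMap.proj (R := ℝ) (φ := fun _ : Fin n => ℝ) i).smulRight (bil (M i))

lemma bil_apply (M : Fin n → Fin n → ℝ) (u v : E n) :
    bil M u v = ∑ j, ∑ k, M j k * u j * v k := by
  simp only [bil, LinearMap.sum_apply, LinearMap.smulRight_apply, LinearMap.smul_apply,
    LinearMap.proj_apply, smul_eq_mul, Finset.mul_sum]
  exact Finset.sum_congr rfl fun j _ => Finset.sum_congr rfl fun k _ => by ring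

lemma tri_apply (M : Fin n → Fin n → Fin n → ℝ) (u v w : E n) :
    tri M u v w = ∑ i, ∑ j, ∑ k, M i j k * u i * v j * w k := by
  simp only [tri, LinearMap.sum_apply, LinearMap.smulRight_apply, LinearMap.smul_apply,
    LinearMap.proj_apply, smul_eq_mul, bil_apply, Finset.mul_sum]
  exact Finset.sum_congr rfl fun i _ => Finset.sum_congr rfl fun j _ =>
    Finset.sum_congr rfl fun k _ => by ring

lemma bil_e (M : Fin n → Fin n → ℝ) (i j : Fin n) : bil M (e n i) (e n j) = M i j := by
  simp [bil_apply, e, Pi.single_apply]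

lemma tri_e (M : Fin n → Fin n → Fin n → ℝ) (i j k : Fin n) :
    tri M (e n i) (e n j) (e n k) = M i j k := by
  simp [tri_apply, e, Pi.single_apply]

lemma bil_symm (M : Fin n → Fin n → ℝ) (h : ∀ i j, M i j = M j i) (u v : E n) :
    bil M u v = bil M v u := by
  rw [bil_apply, bil_apply, Finset.sum_comm]
  exact Finset.sum_congr rfl fun j _ => Finset.sum_congr rfl fun k _ => by rw [h]; ring

lemma tri_symm1 (M : Fin n → Fin n → Fin n → ℝ) (h : ∀ i j k, M i j k = M j i k) (u v w : E n) :
    tri M u v w = tri M v u w := by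
  rw [tri_apply, tri_apply, Finset.sum_comm]
  exact Finset.sum_congr rfl fun j _ => Finset.sum_congr rfl fun k _ =>
    Finset.sum_congr rfl fun l _ => by rw [h]; ring

lemma tri_symm2 (M : Fin n → Fin n → Fin n → ℝ) (h : ∀ i j k, M i j k = M i k j) (u v w : E n) :
    tri M u v w = tri M u w v := by
  rw [tri_apply, tri_apply]
  refine Finset.sum_congr rfl fun i _ => ?_
  rw [Finset.sum_comm]
  exact Finset.sum_congr rfl fun j _ => Finset.sum_congr rfl fun k _ => by rw [h]; ring

lemma vec_eq_sum (u : E n) : u = ∑ i, u i • e n i := by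
  ext j
  simp [e, Finset.sum_apply, Pi.single_apply]

end forms

section homog
variable {n : ℕ} {U : Set (E n)} {F : E n → E n → ℝ}

/-- directional fibre derivative -/
lemma DD_fibre (x y v : E n) (f : E n → E n → ℝ) :
    DD (0, v) f x y = ∑ i, v i * DD (fy n i) f x y := by
  rw [DD_lin]; simp [fy]

/-- derivative along fibre lines -/
lemma DD_line (hU : IsOpen U) {f : E n → E n → ℝ} (hf : Sm U f) {x y : E n} (hx : x ∈ U)
    (hy : y ≠ 0) (v : E n) : HasDerivAt (fun t : ℝ => f x (y + t • v)) (DD (0, v) f x y) 0 := by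
  have h1 := (hf.diff hU hx hy).hasFDerivAt
  have h2 : HasDerivAt (fun t : ℝ => ((x, y + t • v) : E n × E n)) (0, v) 0 := by
    have h3 : HasDerivAt (fun t : ℝ => y + t • v) v 0 := by
      simpa using ((hasDerivAt_id (0 : ℝ)).smul_const v).const_add y
    exact (hasDerivAt_const (0 : ℝ) x).prodMk h3
  have h4 : HasFDerivAt (fun p : E n × E n => f p.1 p.2)
      (fderiv ℝ (fun p : E n × E n => f p.1 p.2) (x, y)) (x, y + (0 : ℝ) • v) := by
    simpa using h1
  exact h4.comp_hasDerivAt (0 : ℝ) h2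

lemma euler_F (hU : IsOpen U) (hF : IsFinsler n U F) {x y : E n} (hx : x ∈ U) (hy : y ≠ 0) :
    DD (0, y) F x y = F x y := by
  have h1 := DD_line hU (smF hF) hx hy y
  have h2 : HasDerivAt (fun t : ℝ => (1 + t) * F x y) (F x y) 0 := by
    simpa using ((hasDerivAt_id (0 : ℝ)).const_add 1).mul_const (F x y)
  refine h1.unique (h2.congr_of_eventuallyEq ?_)
  filter_upwards [lt_mem_nhds (show (-1 : ℝ) < 0 by norm_num)] with t ht
  have : y + t • y = (1 + t) • y := by rw [add_smul, one_smul]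
  rw [this, hF.homog x hx y hy _ (by linarith)]

lemma DD_F2 (hU : IsOpen U) (hF : IsFinsler n U F) (u : E n × E n) {x y : E n} (hx : x ∈ U)
    (hy : y ≠ 0) : DD u (F2 n F) x y = 2 * F x y * DD u F x y := by
  have : F2 n F = fun x y => F x y * F x y := by funext x y; simp [F2, pow_two]
  rw [this, DD_mul hU (smF hF) (smF hF) u x hx y hy]
  ring

lemma Fy_DD (hU : IsOpen U) (hF : IsFinsler n U F) (i : Fin n) {x y : E n} (hx : x ∈ U)
    (hy : y ≠ 0) : Fy n F i x y = DD (fy n i) F x y := pdy_eq hU (smF hF) i x hx y hy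

lemma y_Fy (hU : IsOpen U) (hF : IsFinsler n U F) {x y : E n} (hx : x ∈ U) (hy : y ≠ 0) :
    ∑ j, y j * Fy n F j x y = F x y := by
  simp only [Fy_DD hU hF _ hx hy]
  rw [← DD_fibre, euler_F hU hF hx hy]

lemma euler_Q (hU : IsOpen U) (hF : IsFinsler n U F) :
    EqOm U (fun x y => ∑ k, y k * DD (fy n k) (F2 n F) x y) (fun x y => 2 * F2 n F x y) := by
  intro x hx y hy
  simp only
  rw [← DD_fibre, DD_F2 hU hF _ hx hy, euler_F hU hF hx hy, F2]
  ring

lemma y_gm (hU : IsOpen U) (hF : IsFinsler n U F) (j : Fin n) :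
    EqOm U (fun x y => ∑ k, y k * gm n F k j x y) (fun x y => (1 / 2) * DD (fy n j) (F2 n F) x y) := by
  intro x hx y hy
  have h := smF2 hF
  have e := DD_congr hU (euler_Q hU hF) (fy n j) x hx y hy
  rw [DD_sum hU (fun k => (Sm.coord k).mul (h.DD hU _)) _ x hx y hy, DD_cmul hU h _ _ x hx y hy] at e
  have e2 : ∑ k, DD (fy n j) (fun x y => y k * DD (fy n k) (F2 n F) x y) x y
      = ∑ k, (fy n j).2 k * DD (fy n k) (F2 n F) x y + 2 * ∑ k, y k * gm n F k j x y := by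
    rw [Finset.mul_sum, ← Finset.sum_add_distrib]
    refine Finset.sum_congr rfl fun k _ => ?_
    rw [DD_mul hU (Sm.coord k) (h.DD hU _) _ x hx y hy, DD_coord, gm_symm hU hF k j x hx y hy,
      gm_DD hU hF j k x hx y hy]
    ring
  have e3 : ∑ k, (fy n j).2 k * DD (fy n k) (F2 n F) x y = DD (fy n j) (F2 n F) x y :=
    e_apply_sum j _
  rw [e2, e3] at e
  simp only
  linarith

lemma y_gm' (hU : IsOpen U) (hF : IsFinsler n U F) (j : Fin n) {x y : E n} (hx : x ∈ U)
    (hy : y ≠ 0) : ∑ k, y k * gm n F k j x y = F x y * Fy n F j x y := by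
  have e := y_gm hU hF j x hx y hy
  simp only at e
  rw [e, Fy_DD hU hF j hx hy, DD_F2 hU hF _ hx hy]
  ring

lemma Cartan_DD (hU : IsOpen U) (hF : IsFinsler n U F) (i j k : Fin n) {x y : E n} (hx : x ∈ U)
    (hy : y ≠ 0) : Cartan n F i j k x y =
      (1 / 4) * DD (fy n i) (DD (fy n j) (DD (fy n k) (F2 n F))) x y := by
  have h := smF2 hF
  simp only [Cartan]
  rw [pdy_eq hU ((h.pdy hU k).pdy hU j) i x hx y hy,
    DD_congr hU (pdy_eq hU (h.pdy hU k) j) _ x hx y hy,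
    DD_congr hU (DD_congr hU (pdy_eq hU h k) _) _ x hx y hy]
  rfl

lemma Cartan_symm1 (hU : IsOpen U) (hF : IsFinsler n U F) (i j k : Fin n) {x y : E n} (hx : x ∈ U)
    (hy : y ≠ 0) : Cartan n F i j k x y = Cartan n F j i k x y := by
  rw [Cartan_DD hU hF _ _ _ hx hy, Cartan_DD hU hF _ _ _ hx hy,
    DD_comm hU ((smF2 hF).DD hU _) _ _ x hx y hy]

lemma Cartan_symm2 (hU : IsOpen U) (hF : IsFinsler n U F) (i j k : Fin n) {x y : E n} (hx : x ∈ U)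
    (hy : y ≠ 0) : Cartan n F i j k x y = Cartan n F i k j x y := by
  rw [Cartan_DD hU hF _ _ _ hx hy, Cartan_DD hU hF _ _ _ hx hy,
    DD_congr hU (DD_comm hU (smF2 hF) _ _) _ x hx y hy]

lemma y_Cartan (hU : IsOpen U) (hF : IsFinsler n U F) (i j : Fin n) {x y : E n} (hx : x ∈ U)
    (hy : y ≠ 0) : ∑ k, y k * Cartan n F i j k x y = 0 := by
  have h := smF2 hF
  have e := DD_congr hU (y_gm hU hF j) (fy n i) x hx y hy
  rw [DD_sum hU (fun k => (Sm.coord k).mul (smgm hU hF _ _)) _ x hx y hy,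
    DD_cmul hU (h.DD hU _) _ _ x hx y hy] at e
  have e2 : ∑ k, DD (fy n i) (fun x y => y k * gm n F k j x y) x y
      = ∑ k, (fy n i).2 k * gm n F k j x y + 2 * ∑ k, y k * Cartan n F i j k x y := by
    rw [Finset.mul_sum, ← Finset.sum_add_distrib]
    refine Finset.sum_congr rfl fun k _ => ?_
    rw [DD_mul hU (Sm.coord k) (smgm hU hF _ _) _ x hx y hy, DD_coord,
      Cartan_symm2 hU hF _ _ _ hx hy, Cartan_DD hU hF _ _ _ hx hy,
      DD_congr hU (gm_DD hU hF k j) _ x hx y hy, DD_cmul hU ((h.DD hU _).DD hU _) _ _ x hx y hy]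
    ring
  have e3 : ∑ k, (fy n i).2 k * gm n F k j x y = gm n F i j x y := e_apply_sum i _
  have e4 := gm_DD hU hF i j x hx y hy
  simp only at e4
  rw [e2, e3] at e
  linarith

end homog

section final
variable {n : ℕ} {U : Set (E n)} {F : E n → E n → ℝ}

lemma smRiem (hU : IsOpen U) (hF : IsFinsler n U F) (i k : Fin n) : Sm U (RiemUp n F i k) := by
  have hS := smSpray hU hF
  exact ((((Sm.const 2).mul ((hS i).pdx hU k)).sub
    (Sm.sum fun j => (Sm.coord j).mul (((hS i).pdy hU k).pdx hU j))).add
    ((Sm.const 2).mul (Sm.sum fun j => (hS j).mul (((hS i).pdy hU k).pdy hU j)))).sub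
    (Sm.sum fun j => ((hS i).pdy hU j).mul ((hS j).pdy hU k))

lemma smRlow (hU : IsOpen U) (hF : IsFinsler n U F) (j k : Fin n) : Sm U (Rlow n F j k) :=
  Sm.sum fun i => (smgm hU hF i j).mul (smRiem hU hF i k)

lemma DD2 (hU : IsOpen U) {f : E n → E n → ℝ} (hf : Sm U f) (v : E n) {x y : E n} (hx : x ∈ U)
    (hy : y ≠ 0) : DD (0, v) (DD (0, v) f) x y =
      ∑ j, ∑ k, v j * (v k * DD (fy n k) (DD (fy n j) f) x y) := by
  rw [DD_fibre]
  refine Finset.sum_congr rfl fun j _ => ?_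
  rw [DD_comm hU hf _ _ x hx y hy, DD_fibre, Finset.mul_sum]

lemma DD3 (hU : IsOpen U) {f : E n → E n → ℝ} (hf : Sm U f) (v : E n) {x y : E n} (hx : x ∈ U)
    (hy : y ≠ 0) : DD (0, v) (DD (0, v) (DD (0, v) f)) x y =
      ∑ i, ∑ j, ∑ k, v i * (v j * (v k * DD (fy n k) (DD (fy n j) (DD (fy n i) f)) x y)) := by
  rw [DD_fibre]
  refine Finset.sum_congr rfl fun j _ => ?_
  rw [DD_comm hU (hf.DD hU _) _ _ x hx y hy, DD_congr hU (DD_comm hU hf _ _) _ x hx y hy,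
    DD2 hU (hf.DD hU _) v hx hy, Finset.mul_sum]
  simp only [Finset.mul_sum]

/-- bilinear form of the fundamental tensor -/
lemma bil_hm (x y u v : E n) : bil (fun i j => hm n F i j x y) u v =
    bil (fun i j => gm n F i j x y) u v - (∑ j, u j * Fy n F j x y) * (∑ j, v j * Fy n F j x y) := by
  rw [Finset.sum_mul_sum]
  simp only [bil_apply, hm, ← Finset.sum_sub_distrib]
  exact Finset.sum_congr rfl fun j _ => Finset.sum_congr rfl fun k _ => by ring

lemma bil_gy (hU : IsOpen U) (hF : IsFinsler n U F) {x y : E n} (hx : x ∈ U) (hy : y ≠ 0)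
    (v : E n) : bil (fun i j => gm n F i j x y) y v = F x y * ∑ j, v j * Fy n F j x y := by
  rw [bil_apply, Finset.sum_comm, Finset.mul_sum]
  refine Finset.sum_congr rfl fun k _ => ?_
  have := y_gm' hU hF k hx hy
  calc ∑ j, gm n F j k x y * y j * v k = (∑ j, y j * gm n F j k x y) * v k := by
        rw [Finset.sum_mul]; exact Finset.sum_congr rfl fun _ _ => by ring
    _ = _ := by rw [this]; ring

lemma hm_symm (hU : IsOpen U) (hF : IsFinsler n U F) {x y : E n} (hx : x ∈ U) (hy : y ≠ 0)
    (i j : Fin n) : hm n F i j x y = hm n F j i x y := by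
  simp only [hm]; rw [gm_symm hU hF i j x hx y hy]; ring

lemma hm_y (hU : IsOpen U) (hF : IsFinsler n U F) {x y : E n} (hx : x ∈ U) (hy : y ≠ 0)
    (v : E n) : bil (fun i j => hm n F i j x y) y v = 0 := by
  rw [bil_hm, bil_gy hU hF hx hy, y_Fy hU hF hx hy]; ring

lemma hm_pos (hU : IsOpen U) (hF : IsFinsler n U F) {x y : E n} (hx : x ∈ U) (hy : y ≠ 0)
    (v : E n) (hv : ∀ c : ℝ, c • y ≠ v) : 0 < bil (fun i j => hm n F i j x y) v v := by
  have hFp := hF.pos x hx y hy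
  set f := ∑ j, v j * Fy n F j x y with hf
  set w := v - (f / F x y) • y with hw
  have hw0 : w ≠ 0 := fun h => hv (f / F x y) (sub_eq_zero.1 h).symm
  have h1 : 0 < bil (fun i j => gm n F i j x y) w w := by
    have := (hF.posdef x hx y hy).dotProduct_mulVec_pos hw0
    rw [bil_apply]
    simp only [dotProduct, Matrix.mulVec, gmat, Matrix.of_apply, Finset.mul_sum, star_trivial] at this
    refine this.trans_eq ?_
    exact Finset.sum_congr rfl fun j _ => Finset.sum_congr rfl fun k _ => by ring
  have gs := bil_symm (fun i j => gm n F i j x y) (fun i j => gm_symm hU hF i j x hx y hy)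
  have h2 : bil (fun i j => gm n F i j x y) w w = bil (fun i j => hm n F i j x y) v v := by
    rw [bil_hm]
    simp only [hw, map_sub, map_smul, LinearMap.sub_apply, LinearMap.smul_apply, smul_eq_mul]
    rw [gs v y, bil_gy hU hF hx hy, bil_gy hU hF hx hy, y_Fy hU hF hx hy, ← hf]
    field_simp
    ring
  rw [← h2]; exact h1

/-- `F² h(v,v)` through derivatives of `F²` -/
lemma denom_eq (hU : IsOpen U) (hF : IsFinsler n U F) (v : E n) :
    EqOm U (fun x y => (F x y) ^ 2 * bil (fun i j => hm n F i j x y) v v)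
      (fun x y => (1 / 2) * (F2 n F x y * DD (0, v) (DD (0, v) (F2 n F)) x y)
        - (1 / 4) * (DD (0, v) (F2 n F) x y * DD (0, v) (F2 n F) x y)) := by
  intro x hx y hy
  simp only
  have e1 : DD (0, v) (F2 n F) x y = 2 * F x y * ∑ j, v j * Fy n F j x y := by
    rw [DD_F2 hU hF _ hx hy, DD_fibre]
    simp only [Fy_DD hU hF _ hx hy]
  have e2 : DD (0, v) (DD (0, v) (F2 n F)) x y = 2 * bil (fun i j => gm n F i j x y) v v := by
    rw [DD2 hU (smF2 hF) v hx hy, bil_apply]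
    simp only [Finset.mul_sum]
    refine Finset.sum_congr rfl fun j _ => Finset.sum_congr rfl fun k _ => ?_
    rw [gm_symm hU hF j k x hx y hy, gm_DD hU hF k j x hx y hy]
    ring
  rw [e1, e2, bil_hm, F2]
  ring

lemma sm_denom (hU : IsOpen U) (hF : IsFinsler n U F) (v : E n) :
    Sm U (fun x y => (F x y) ^ 2 * bil (fun i j => hm n F i j x y) v v) := by
  have h := smF2 hF
  exact (((Sm.const _).mul (h.mul ((h.DD hU _).DD hU _))).sub
    ((Sm.const _).mul ((h.DD hU _).mul (h.DD hU _)))).congr (denom_eq hU hF v)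

lemma DD_denom (hU : IsOpen U) (hF : IsFinsler n U F) (v : E n) {x y : E n} (hx : x ∈ U)
    (hy : y ≠ 0) :
    DD (0, v) (fun x y => (F x y) ^ 2 * bil (fun i j => hm n F i j x y) v v) x y
      = 2 * (F x y) ^ 2 * tri (fun i j k => Cartan n F i j k x y) v v v := by
  have h := smF2 hF
  have h' := h.DD hU (0, v)
  have h'' := h'.DD hU (0, v)
  rw [DD_congr hU (denom_eq hU hF v) _ x hx y hy,
    DD_sub hU ((Sm.const _).mul (h.mul h'')) ((Sm.const _).mul (h'.mul h')) _ x hx y hy,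
    DD_cmul hU (h.mul h'') _ _ x hx y hy, DD_cmul hU (h'.mul h') _ _ x hx y hy,
    DD_mul hU h h'' _ x hx y hy, DD_mul hU h' h' _ x hx y hy]
  have e3 : DD (0, v) (DD (0, v) (DD (0, v) (F2 n F))) x y
      = 4 * tri (fun i j k => Cartan n F i j k x y) v v v := by
    rw [DD3 hU h v hx hy, tri_apply]
    simp only [Finset.mul_sum]
    refine Finset.sum_congr rfl fun i _ => Finset.sum_congr rfl fun j _ =>
      Finset.sum_congr rfl fun k _ => ?_
    rw [Cartan_symm2 hU hF i j k hx hy, Cartan_symm1 hU hF i k j hx hy,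
      Cartan_symm2 hU hF k i j hx hy, Cartan_DD hU hF k j i hx hy]
    ring
  rw [e3, F2]
  ring

lemma num_eq (x y v : E n) : bil (fun i j => Rlow n F i j x y) v v
    = ∑ j, ∑ k, (v j * v k) * Rlow n F j k x y := by
  rw [bil_apply]
  exact Finset.sum_congr rfl fun j _ => Finset.sum_congr rfl fun k _ => by ring

lemma sm_num (hU : IsOpen U) (hF : IsFinsler n U F) (v : E n) :
    Sm U (fun x y => bil (fun i j => Rlow n F i j x y) v v) := by
  simp only [num_eq]
  exact Sm.sum fun j => Sm.sum fun k => (Sm.const _).mul (smRlow hU hF j k)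

lemma DD_num (hU : IsOpen U) (hF : IsFinsler n U F) (v : E n) {x y : E n} (hx : x ∈ U)
    (hy : y ≠ 0) :
    DD (0, v) (fun x y => bil (fun i j => Rlow n F i j x y) v v) x y
      = tri (fun i j k => DD (fy n i) (Rlow n F j k) x y) v v v := by
  have hR := smRlow hU hF
  simp only [num_eq]
  rw [DD_fibre, tri_apply]
  refine Finset.sum_congr rfl fun i _ => ?_
  rw [DD_sum hU (fun j => Sm.sum fun k => (Sm.const _).mul (hR j k)) _ x hx y hy, Finset.mul_sum]
  refine Finset.sum_congr rfl fun j _ => ?_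
  rw [DD_sum hU (fun k => (Sm.const _).mul (hR j k)) _ x hx y hy, Finset.mul_sum]
  refine Finset.sum_congr rfl fun k _ => ?_
  rw [DD_cmul hU (hR j k) _ _ x hx y hy]
  ring

lemma K_eq (x y v : E n) : K n F x y v = bil (fun i j => Rlow n F i j x y) v v
    / ((F x y) ^ 2 * bil (fun i j => hm n F i j x y) v v) := by
  simp only [K, bil_apply]

lemma span_shift (y v : E n) (t : ℝ) :
    Submodule.span ℝ {y, v} = Submodule.span ℝ {y + t • v, v} := by
  apply le_antisymm <;> rw [Submodule.span_le] <;> rintro z (rfl | rfl)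
  · have h1 : z + t • v ∈ Submodule.span ℝ {z + t • v, v} := Submodule.subset_span (by simp)
    have h2 : v ∈ Submodule.span ℝ {z + t • v, v} := Submodule.subset_span (by simp)
    have := Submodule.sub_mem _ h1 (Submodule.smul_mem _ t h2)
    simpa using this
  · exact Submodule.subset_span (by simp)
  · have h1 : y ∈ Submodule.span ℝ {y, v} := Submodule.subset_span (by simp)
    have h2 : v ∈ Submodule.span ℝ {y, v} := Submodule.subset_span (by simp)
    exact Submodule.add_mem _ h1 (Submodule.smul_mem _ t h2)
  · exact Submodule.subset_span (by simp)

lemma sec_step (hU : IsOpen U) (hF : IsFinsler n U F) (hsec : SectionalFlagCurv n U F)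
    {x y : E n} (hx : x ∈ U) (hy : y ≠ 0) (v : E n) (hv : ∀ c : ℝ, c • y ≠ v) :
    tri (fun i j k => DD (fy n i) (Rlow n F j k) x y) v v v
        * bil (fun i j => hm n F i j x y) v v
      = 2 * tri (fun i j k => Cartan n F i j k x y) v v v * bil (fun i j => Rlow n F i j x y) v v := by
  have hli : LinearIndependent ℝ ![y, v] := (LinearIndependent.pair_iff' hy).2 hv
  have hlit : ∀ t : ℝ, LinearIndependent ℝ ![y + t • v, v] := by
    intro t
    rw [LinearIndependent.pair_iff] at hli ⊢
    intro a b hab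
    obtain ⟨h1, h2⟩ := hli a (a * t + b) (by rw [← hab]; module)
    subst h1
    simpa using h2
  have hyt : ∀ t : ℝ, y + t • v ≠ 0 := fun t => (hlit t).ne_zero 0
  have hpos : ∀ t : ℝ, 0 < (F x (y + t • v)) ^ 2 * bil (fun i j => hm n F i j x (y + t • v)) v v := by
    intro t
    exact mul_pos (pow_pos (hF.pos x hx _ (hyt t)) 2)
      (hm_pos hU hF hx (hyt t) v ((LinearIndependent.pair_iff' (hyt t)).1 (hlit t)))
  set κ := K n F x y v with hκ
  have hfun : (fun t : ℝ => bil (fun i j => Rlow n F i j x (y + t • v)) v v) =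
      fun t : ℝ => κ * ((F x (y + t • v)) ^ 2 * bil (fun i j => hm n F i j x (y + t • v)) v v) := by
    funext t
    have e := hsec x hx y v (y + t • v) v hli (hlit t) (span_shift y v t)
    rw [hκ, e, K_eq, div_mul_cancel₀ _ (hpos t).ne']
  have d1 := DD_line hU (sm_num hU hF v) hx hy v
  have d2 := (DD_line hU (sm_denom hU hF v) hx hy v).const_mul κ
  rw [hfun] at d1
  have d3 := d1.unique d2
  rw [DD_num hU hF v hx hy, DD_denom hU hF v hx hy] at d3
  have d4 := congrFun hfun 0
  simp only [zero_smul, add_zero] at d4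
  rw [d3, d4]
  ring

lemma exists_not_span (hn : 3 ≤ n) (u v : E n) : ∃ w : E n, ∀ a b : ℝ, a • u + b • v ≠ w := by
  by_contra hcon
  push Not at hcon
  have htop : Submodule.span ℝ (({u, v} : Finset (E n)) : Set (E n)) = ⊤ := by
    rw [eq_top_iff]
    intro w _
    obtain ⟨a, b, rfl⟩ := hcon w
    exact Submodule.add_mem _ (Submodule.smul_mem _ _ (Submodule.subset_span (by simp)))
      (Submodule.smul_mem _ _ (Submodule.subset_span (by simp)))
  have h1 := finrank_span_finset_le_card (R := ℝ) ({u, v} : Finset (E n))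
  rw [Set.finrank, htop, finrank_top, Module.finrank_fin_fun] at h1
  have h2 : ({u, v} : Finset (E n)).card ≤ 2 := Finset.card_le_two
  omega

end final

/-- For a Finsler metric of sectional flag curvature in dimension ≥ 3,
every nonzero tangent vector is either a polar direction or a Matsumoto direction. -/
theorem polar_or_matsumoto (n : ℕ) (hn : 3 ≤ n)
    (U : Set (E n)) (hU : IsOpen U) (F : E n → E n → ℝ)
    (hF : IsFinsler n U F) (hsec : SectionalFlagCurv n U F) :
    ∀ x ∈ U, ∀ y : E n, y ≠ 0 →
      IsPolarDir n F x y ∨ ∀ i j k : Fin n, Matsumoto n F i j k x y = 0 := by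
  intro x hx y hy
  have hFp := hF.pos x hx y hy
  set h := bil (fun i j => hm n F i j x y) with hh
  set R := bil (fun i j => Rlow n F i j x y) with hR
  set C := tri (fun i j k => Cartan n F i j k x y) with hC
  set T := tri (fun i j k => DD (fy n i) (Rlow n F j k) x y) with hT
  have hs : ∀ u v, h u v = h v u := bil_symm _ fun i j => hm_symm hU hF hx hy i j
  have Rs : ∀ u v, R u v = R v u := bil_symm _ fun i j => Rlow_symm hU hF i j x hx y hy
  have C1 : ∀ u v w, C u v w = C v u w := tri_symm1 _ fun i j k => Cartan_symm1 hU hF i j k hx hy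
  have C2 : ∀ u v w, C u v w = C u w v := tri_symm2 _ fun i j k => Cartan_symm2 hU hF i j k hx hy
  have hy0 : ∀ v, h y v = 0 := hm_y hU hF hx hy
  have Cy : ∀ u v, C u v y = 0 := by
    intro u v
    rw [hC, tri_apply]
    refine Finset.sum_eq_zero fun i _ => Finset.sum_eq_zero fun j _ => ?_
    have := y_Cartan hU hF i j hx hy
    calc ∑ k, Cartan n F i j k x y * u i * v j * y k
        = u i * v j * ∑ k, y k * Cartan n F i j k x y := by
          rw [Finset.mul_sum]; exact Finset.sum_congr rfl fun _ _ => by ring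
      _ = 0 := by rw [this, mul_zero]
  have hpos : ∀ v, (∀ c : ℝ, c • y ≠ v) → 0 < h v v := hm_pos hU hF hx hy
  have hTC : ∀ v, T v v v * h v v = 2 * C v v v * R v v := by
    intro v
    by_cases hv : ∀ c : ℝ, c • y ≠ v
    · exact sec_step hU hF hsec hx hy v hv
    · push Not at hv
      obtain ⟨c, rfl⟩ := hv
      simp [hy0, Cy]
  have hnn : ∀ u, 0 ≤ h u u := by
    intro u
    by_cases hu : ∀ c : ℝ, c • y ≠ u
    · exact (hpos u hu).le
    · push Not at hu
      obtain ⟨c, rfl⟩ := hu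
      simp [hy0]
  have hker : ∀ u, h u u = 0 → ∀ v, h u v = 0 := by
    intro u hu v
    by_cases hu' : ∀ c : ℝ, c • y ≠ u
    · exact absurd hu (hpos u hu').ne'
    · push Not at hu'
      obtain ⟨c, rfl⟩ := hu'
      simp [hy0]
  obtain ⟨a0, ha0⟩ := exists_not_span hn y 0
  have ha0p : 0 < h a0 a0 := hpos a0 fun c => by simpa using ha0 c 0
  obtain ⟨w0, hw0⟩ := exists_not_span hn y a0
  set r := Real.sqrt (h a0 a0) with hr
  have hrp : 0 < r := Real.sqrt_pos.2 ha0p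
  have hrr : r * r = h a0 a0 := Real.mul_self_sqrt ha0p.le
  set a := r⁻¹ • a0 with ha
  have ha1 : h a a = 1 := by
    simp only [ha, map_smul, LinearMap.smul_apply, smul_eq_mul, ← hrr]
    field_simp
  set w1 := w0 - h a w0 • a with hw1
  have hw1a : h a w1 = 0 := by simp [hw1, ha1]
  have hw1p : 0 < h w1 w1 := by
    apply hpos
    intro c hc
    apply hw0 c (h a w0 * r⁻¹)
    rw [hc, hw1, ha, mul_smul]
    abel
  rcases alg_main h R C T hs Rs C1 C2 hTC hnn hker a ha1 w1 hw1a hw1p with hp | hm'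
  · left
    refine ⟨R a a / (F x y) ^ 2, fun j k => ?_⟩
    have e0 := hp (e n j) (e n k)
    have b1 : R (e n j) (e n k) = Rlow n F j k x y := bil_e _ _ _
    have b2 : h (e n j) (e n k) = hm n F j k x y := bil_e _ _ _
    rw [b1, b2] at e0
    rw [e0]
    field_simp
  · right
    set θ : Fin n → ℝ := fun k => 3 * C a a (e n k) - 2 * C a a a * h a (e n k) with hθ
    have hCθ : ∀ i j k, 3 * Cartan n F i j k x y = hm n F i j x y * θ k + hm n F j k x y * θ i
        + hm n F k i x y * θ j := by
      intro i j k
      have e0 := hm' (e n i) (e n j) (e n k)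
      have c : C (e n i) (e n j) (e n k) = Cartan n F i j k x y := tri_e _ _ _ _
      have b : ∀ i j, h (e n i) (e n j) = hm n F i j x y := fun i j => bil_e _ _ _
      rw [c, b, b, b] at e0
      exact e0
    have hθy : ∑ k, y k * θ k = 0 := by
      have e1 : C a a y = ∑ k, y k * C a a (e n k) := by
        conv_lhs => rw [vec_eq_sum y]
        simp only [map_sum, map_smul, smul_eq_mul]
      have e2 : h a y = ∑ k, y k * h a (e n k) := by
        conv_lhs => rw [vec_eq_sum y]
        simp only [map_sum, map_smul, smul_eq_mul]
      have e3 : ∑ k, y k * θ k = 3 * C a a y - 2 * C a a a * h a y := by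
        rw [e1, e2, Finset.mul_sum, Finset.mul_sum, ← Finset.sum_sub_distrib]
        exact Finset.sum_congr rfl fun k _ => by simp only [hθ]; ring
      rw [e3, Cy, hs, hy0]; ring
    have hdet : IsUnit (gmat n F x y).det := (hF.posdef x hx y hy).det_pos.ne'.isUnit
    have i1 : ∀ i k, ∑ j, gm n F i j x y * ginv n F x y j k = if i = k then 1 else 0 := by
      intro i k
      have := congrFun (congrFun (Matrix.mul_nonsing_inv _ hdet) i) k
      rw [Matrix.mul_apply, Matrix.one_apply] at this
      exact this
    have i2 : ∀ i k, ∑ j, ginv n F x y i j * gm n F j k x y = if i = k then 1 else 0 := by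
      intro i k
      have := congrFun (congrFun (Matrix.nonsing_inv_mul _ hdet) i) k
      rw [Matrix.mul_apply, Matrix.one_apply] at this
      exact this
    have hI : ∀ i, 3 * meanCartan n F i x y = ((n : ℝ) + 1) * θ i := by
      intro i
      exact trace_step (fun i j => gm n F i j x y) (fun i j => ginv n F x y i j)
        (fun i j => hm n F i j x y) (fun i j k => Cartan n F i j k x y)
        (fun i => Fy n F i x y) y θ (F x y) hFp.ne' (fun i j => gm_symm hU hF i j x hx y hy)
        i1 i2 (fun i j => rfl) (fun j => y_gm' hU hF j hx hy) (y_Fy hU hF hx hy) hθy hCθ i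
    intro i j k
    have hn1 : ((n : ℝ) + 1) ≠ 0 := by positivity
    have hI' : ∀ i, meanCartan n F i x y = ((n : ℝ) + 1) * (θ i / 3) := fun i => by
      linear_combination (1 / 3) * hI i
    simp only [Matsumoto]
    rw [hI', hI', hI']
    field_simp
    linear_combination hCθ i j k

end Paper
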